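/- Let L be a 3-component string link with parameter R > 0. For every ε > 0 there exists T > 0 such that for all t₁, t₂, t₃ ∈ ℝ and every x ∈ E³ with ‖x‖ ≥ T and x ≠ L(i, tᵢ) for i = 1, 2, 3, the triple (unit(x − L(1,t₁)), unit(x − L(2,t₂)), unit(x − L(3,t₃))) lies within distance ε of (H₊ × H₊ × H₊) ∪ (H₋ × H₋ × H₋). (This is the part of the degenerate locus arising from configurations in which the free vertex escapes to infinity.) -/

import Mathlib

noncomputable section

open Metric Set

/-- `E³ = EuclideanSpace ℝ (Fin 3)`. -/
abbrev E3 := EuclideanSpace ℝ (Fin 3)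

/-- The vector `(a, b, c)` in `E³`. -/
def mkE3 (a b c : ℝ) : E3 := (WithLp.equiv 2 (Fin 3 → ℝ)).symm ![a, b, c]

/-- `unit(w) = ‖w‖⁻¹ • w`. -/
def unitVec (w : E3) : E3 := ‖w‖⁻¹ • w

/-- `dᵢ⁺`: the unit vector in the direction `(i − (k+1)/2, 1, 0)`, where the components of a
`k`-component string link are indexed by `i = 1, …, k` (so `i : Fin k` stands for `i + 1`). -/
def dplus (k : ℕ) (i : Fin k) : E3 :=
  unitVec (mkE3 ((i : ℝ) + 1 - ((k : ℝ) + 1) / 2) 1 0)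

/-- `dᵢ⁻`: the unit vector in the direction `(i − (k+1)/2, −1, 0)`. -/
def dminus (k : ℕ) (i : Fin k) : E3 :=
  unitVec (mkE3 ((i : ℝ) + 1 - ((k : ℝ) + 1) / 2) (-1) 0)

/-- A `k`-component string link with parameter `R`. -/
def IsStringLink (k : ℕ) (R : ℝ) (L : Fin k × ℝ → E3) : Prop :=
  Continuous L ∧ Function.Injective L ∧
    (∀ i t, |t| ≤ R → ‖L (i, t)‖ ≤ R) ∧
    (∀ i t, R ≤ t → L (i, t) = t • dplus k i) ∧
    (∀ i t, t ≤ -R → L (i, t) = (-t) • dminus k i)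

/-- The unit sphere `S²` in `E³`. -/
def S2 : Set E3 := Metric.sphere 0 1

/-- The equator `C = {v ∈ S² : v 2 = 0}`. -/
def Ceq : Set E3 := {v ∈ S2 | v 2 = 0}

/-- The closed half-equator `C₊ = {v ∈ C : v 0 ≥ 0}`. -/
def Cpos : Set E3 := {v ∈ Ceq | 0 ≤ v 0}

/-- The closed half-equator `C₋ = {v ∈ C : v 0 ≤ 0}`. -/
def Cneg : Set E3 := {v ∈ Ceq | v 0 ≤ 0}

/-- The closed upper hemisphere `H₊`. -/
def Hpos : Set E3 := {v ∈ S2 | 0 ≤ v 2}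

/-- The closed lower hemisphere `H₋`. -/
def Hneg : Set E3 := {v ∈ S2 | v 2 ≤ 0}

lemma unitVec_apply (w : E3) (j : Fin 3) : unitVec w j = ‖w‖⁻¹ * w j := by
  simp [unitVec]

lemma unitVec_neg (w : E3) : unitVec (-w) = -unitVec w := by
  simp [unitVec]

lemma norm_unitVec {w : E3} (hw : w ≠ 0) : ‖unitVec w‖ = 1 := by
  rw [unitVec, norm_smul, norm_inv, norm_norm, inv_mul_cancel₀ (norm_ne_zero_iff.mpr hw)]

lemma abs_apply_le_norm (w : E3) (j : Fin 3) : |w j| ≤ ‖w‖ := by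
  simpa using PiLp.norm_apply_le w j

lemma norm_mkE3 (a b c : ℝ) : ‖mkE3 a b c‖ = √(a ^ 2 + b ^ 2 + c ^ 2) := by
  simp [mkE3, EuclideanSpace.norm_eq, Fin.sum_univ_three]

/-- A unit vector whose height is at least `-ε / 2` is `ε`-close to the upper hemisphere:
reflect it in the equatorial plane if necessary. -/
lemma exists_mem_Hpos_dist_le {v : E3} (hv : ‖v‖ = 1) {ε : ℝ} (hε : 0 ≤ ε)
    (h : -(ε / 2) ≤ v 2) : ∃ p ∈ Hpos, dist v p ≤ ε := by
  refine ⟨mkE3 (v 0) (v 1) |v 2|, ⟨?_, ?_⟩, ?_⟩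
  · rw [S2, mem_sphere_zero_iff_norm, norm_mkE3, sq_abs, ← hv, EuclideanSpace.norm_eq]
    simp [Fin.sum_univ_three]
  · simp [mkE3]
  · have hd : dist v (mkE3 (v 0) (v 1) |v 2|) = abs (v 2 - |v 2|) := by
      rw [EuclideanSpace.dist_eq]
      simp [Fin.sum_univ_three, mkE3, Real.dist_eq, Real.sqrt_sq_eq_abs]
    rw [hd, abs_le]
    constructor <;> cases abs_cases (v 2) <;> linarith

lemma neg_mem_Hneg {p : E3} (hp : p ∈ Hpos) : -p ∈ Hneg := by
  obtain ⟨hs, h2⟩ := hp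
  refine ⟨?_, ?_⟩
  · simpa [S2] using hs
  · simpa using h2

lemma exists_mem_Hpos_dist_unitVec_le {w : E3} (hw : w ≠ 0) {ε : ℝ} (hε : 0 ≤ ε)
    (h : -(ε / 2 * ‖w‖) ≤ w 2) : ∃ p ∈ Hpos, dist (unitVec w) p ≤ ε := by
  refine exists_mem_Hpos_dist_le (norm_unitVec hw) hε ?_
  rw [unitVec_apply, inv_mul_eq_div, le_div_iff₀ (norm_pos_iff.mpr hw)]
  linarith

lemma exists_mem_Hneg_dist_unitVec_le {w : E3} (hw : w ≠ 0) {ε : ℝ} (hε : 0 ≤ ε)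
    (h : w 2 ≤ ε / 2 * ‖w‖) : ∃ p ∈ Hneg, dist (unitVec w) p ≤ ε := by
  obtain ⟨p, hp, hd⟩ := exists_mem_Hpos_dist_unitVec_le (neg_ne_zero.mpr hw) hε
    (by simpa using h)
  refine ⟨-p, neg_mem_Hneg hp, ?_⟩
  rwa [unitVec_neg, ← dist_neg_neg, neg_neg] at hd

/-- Outside the ball of radius `R` a string link is planar. -/
lemma IsStringLink.apply_two_eq_zero {k : ℕ} {R : ℝ} {L : Fin k × ℝ → E3}
    (hL : IsStringLink k R L) (i : Fin k) {t : ℝ} (ht : R < |t|) : L (i, t) 2 = 0 := by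
  obtain ⟨-, -, -, hp, hm⟩ := hL
  rcases lt_abs.mp ht with h | h
  · simp [hp i t h.le, dplus, unitVec, mkE3]
  · simp [hm i t (by linarith), dminus, unitVec, mkE3]

lemma IsStringLink.abs_apply_two_le {k : ℕ} {R : ℝ} {L : Fin k × ℝ → E3}
    (hL : IsStringLink k R L) {ε : ℝ} (hε : 0 < ε) {x : E3} (hx : R + 2 * R / ε ≤ ‖x‖)
    (i : Fin k) (t : ℝ) : |L (i, t) 2| ≤ ε / 2 * ‖x - L (i, t)‖ := by
  rcases le_or_gt |t| R with h | h
  · have hLR := hL.2.2.1 i t h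
    have hn : 2 * R / ε ≤ ‖x - L (i, t)‖ := by
      linarith [norm_sub_norm_le x (L (i, t))]
    calc |L (i, t) 2| ≤ R := (abs_apply_le_norm _ _).trans hLR
      _ = ε / 2 * (2 * R / ε) := by field_simp
      _ ≤ ε / 2 * ‖x - L (i, t)‖ := by gcongr
  · rw [hL.apply_two_eq_zero i h, abs_zero]
    positivity

lemma infDist_le_of_prod_subset {α : Type*} [PseudoMetricSpace α] {A : Set α}
    {B : Set (α × α × α)} (hAB : A ×ˢ A ×ˢ A ⊆ B) {a b c : α} {ε : ℝ}
    (ha : ∃ p ∈ A, dist a p ≤ ε) (hb : ∃ p ∈ A, dist b p ≤ ε) (hc : ∃ p ∈ A, dist c p ≤ ε) :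
    Metric.infDist (a, b, c) B ≤ ε := by
  obtain ⟨p, hp, hpd⟩ := ha
  obtain ⟨q, hq, hqd⟩ := hb
  obtain ⟨r, hr, hrd⟩ := hc
  refine (Metric.infDist_le_dist_of_mem (hAB (mk_mem_prod hp (mk_mem_prod hq hr)))).trans ?_
  simp [Prod.dist_eq, hpd, hqd, hrd]

/-- When the free vertex escapes to infinity, the Gauss map of a configuration of one point on
each strand of a 3-component string link and one free point lands in an arbitrarily small
neighborhood of `(H₊ × H₊ × H₊) ∪ (H₋ × H₋ × H₋)`. -/
theorem gauss_map_free_vertex_at_infinity_close_to_hemispheres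
    (R : ℝ) (hR : 0 < R) (L : Fin 3 × ℝ → E3) (hL : IsStringLink 3 R L) :
    ∀ ε > (0 : ℝ), ∃ T > (0 : ℝ), ∀ (t : Fin 3 → ℝ) (x : E3),
      T ≤ ‖x‖ →
      (∀ i : Fin 3, x ≠ L (i, t i)) →
      Metric.infDist
        (unitVec (x - L (0, t 0)), unitVec (x - L (1, t 1)), unitVec (x - L (2, t 2)))
        ((Hpos ×ˢ Hpos ×ˢ Hpos) ∪ (Hneg ×ˢ Hneg ×ˢ Hneg)) ≤ ε := by
  intro ε hε
  refine ⟨R + 2 * R / ε, by positivity, fun t x hx hne => ?_⟩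
  have hw (i : Fin 3) : x - L (i, t i) ≠ 0 := sub_ne_zero.mpr (hne i)
  have hb (i : Fin 3) := abs_le.mp (hL.abs_apply_two_le hε hx i (t i))
  rcases le_total 0 (x 2) with h2 | h2
  · have key (i : Fin 3) : ∃ p ∈ Hpos, dist (unitVec (x - L (i, t i))) p ≤ ε := by
      refine exists_mem_Hpos_dist_unitVec_le (hw i) hε.le ?_
      rw [PiLp.sub_apply]
      linarith [(hb i).2]
    exact infDist_le_of_prod_subset subset_union_left (key 0) (key 1) (key 2)
  · have key (i : Fin 3) : ∃ p ∈ Hneg, dist (unitVec (x - L (i, t i))) p ≤ ε := by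
      refine exists_mem_Hneg_dist_unitVec_le (hw i) hε.le ?_
      rw [PiLp.sub_apply]
      linarith [(hb i).1]
    exact infDist_le_of_prod_subset subset_union_right (key 0) (key 1) (key 2)
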